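/- arXiv:math/0311258 — 2 statements merged into one kernel-verified Lean document; each statement's English description precedes it below -/
import Mathlib

section
/- If λ is a short root, then D_λ = 0 if λ is a positive root and D_λ = 1 if λ is a negative root. -/
open scoped RealInnerProductSpace

attribute [local instance] Classical.propDecidable

noncomputable section

/-- The reflection in the hyperplane orthogonal to `α`. -/
def sref {V : Type*} [NormedAddCommGroup V] [InnerProductSpace ℝ V] (α x : V) : V :=
  x - (2 * ⟪x, α⟫ / ⟪α, α⟫) • α

/-- The coroot `α^∨ = 2α/(α,α)`. -/
def coroot {V : Type*} [NormedAddCommGroup V] [InnerProductSpace ℝ V] (α : V) : V :=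
  (2 / ⟪α, α⟫) • α

/-- The data of a finite reduced irreducible crystallographic root system `R` in a real
inner product space, together with a fixed choice of positive roots and simple roots. -/
structure RSD (V : Type*) [NormedAddCommGroup V] [InnerProductSpace ℝ V] where
  R : Finset V
  Rpos : Finset V
  n : ℕ
  npos : 0 < n
  simple : Fin n → V
  simple_mem : ∀ i, simple i ∈ Rpos
  pos_sub : Rpos ⊆ R
  root_ne_zero : ∀ α ∈ R, α ≠ 0
  pos_or_neg : ∀ α ∈ R, α ∈ Rpos ∨ -α ∈ Rpos
  not_both : ∀ α ∈ Rpos, -α ∉ Rpos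
  pos_combo : ∀ α ∈ Rpos, ∃ c : Fin n → ℕ, α = ∑ i, (c i : ℝ) • simple i
  simple_indep : LinearIndependent ℝ simple
  reduced : ∀ α ∈ R, ∀ c : ℝ, c • α ∈ R → c = 1 ∨ c = -1
  crystal : ∀ α ∈ R, ∀ β ∈ R, ∃ k : ℤ, ⟪β, coroot α⟫ = (k : ℝ)
  refl_mem : ∀ α ∈ R, ∀ β ∈ R, sref α β ∈ R
  spanning : Submodule.span ℝ (R : Set V) = ⊤
  irred : ∀ s : Set V, (∀ α ∈ R, ∀ β ∈ R, α ∈ s → β ∉ s → ⟪α, β⟫ = 0) →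
    (∀ α ∈ R, α ∈ s) ∨ (∀ α ∈ R, α ∉ s)

namespace RSD

variable {V : Type*} [NormedAddCommGroup V] [InnerProductSpace ℝ V]

/-- The map of `V` determined by a word in the simple reflections. -/
def wordMap (S : RSD V) (l : List (Fin S.n)) : V → V :=
  l.foldr (fun i f => sref (S.simple i) ∘ f) id

/-- `w : V → V` is an element of the Weyl group `W`, i.e. a product of simple reflections. -/
def IsWeyl (S : RSD V) (w : V → V) : Prop := ∃ l : List (Fin S.n), w = S.wordMap l

/-- The length `ℓ(w)` of a Weyl group element: the smallest length of a word in the simple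
reflections representing `w`. -/
def len (S : RSD V) (w : V → V) : ℕ :=
  sInf {k | ∃ l : List (Fin S.n), l.length = k ∧ w = S.wordMap l}

/-- `x` and `y` lie in the same Weyl group orbit. -/
def sameOrbit (S : RSD V) (x y : V) : Prop := ∃ w, S.IsWeyl w ∧ w x = y

/-- `x` is dominant: `(x, α_i) ≥ 0` for all simple roots. -/
def Dominant (S : RSD V) (x : V) : Prop := ∀ i, 0 ≤ ⟪x, S.simple i⟫

/-- `w` is a Weyl group element of minimal length among those sending `x` to `y`. -/
def IsMinWord (S : RSD V) (x y : V) (w : V → V) : Prop :=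
  S.IsWeyl w ∧ w x = y ∧ ∀ w' : V → V, S.IsWeyl w' → w' x = y → S.len w ≤ S.len w'

/-- Membership in the root lattice `Q`, the ℤ-span of the simple roots. -/
def inQ (S : RSD V) (x : V) : Prop :=
  ∃ c : Fin S.n → ℤ, x = ∑ i, (c i : ℝ) • S.simple i

/-- The height `ht(λ) = Σ a_i` of an element `λ = Σ a_i α_i` of the root lattice
(the coefficients are unique since the simple roots are linearly independent). -/
def htZ (S : RSD V) (x : V) : ℤ :=
  if h : ∃ c : Fin S.n → ℤ, x = ∑ i, (c i : ℝ) • S.simple i then ∑ i, h.choose i else 0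

/-- The inversion set `Π(w) = {α ∈ R⁺ : w(α) ∈ R⁻}`. -/
def PiSet (S : RSD V) (w : V → V) : Finset V :=
  S.Rpos.filter (fun α => -(w α) ∈ S.Rpos)

/-- `α` is a short root (if all roots have the same length, all roots are short). -/
def IsShort (S : RSD V) (α : V) : Prop :=
  α ∈ S.R ∧ ∀ β ∈ S.R, ⟪α, α⟫ ≤ ⟪β, β⟫

/-- `α` is a long root. -/
def IsLong (S : RSD V) (α : V) : Prop :=
  α ∈ S.R ∧ ∀ β ∈ S.R, ⟪β, β⟫ ≤ ⟪α, α⟫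

/-- The short roots in the inversion set `Π(w)`. -/
def PiS (S : RSD V) (w : V → V) : Finset V :=
  (S.PiSet w).filter (fun α => S.IsShort α)

/-- The long roots in the inversion set `Π(w)`. -/
def PiL (S : RSD V) (w : V → V) : Finset V :=
  (S.PiSet w).filter (fun α => S.IsLong α)

end RSD


section Reflections

variable {V : Type*} [NormedAddCommGroup V] [InnerProductSpace ℝ V]

theorem inner_sref_left (α x y : V) :
    ⟪sref α x, y⟫ = ⟪x, y⟫ - 2 * ⟪x, α⟫ / ⟪α, α⟫ * ⟪α, y⟫ := by
  simp [sref, inner_sub_left, real_inner_smul_left]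

theorem inner_sref_comm (α x y : V) : ⟪sref α x, y⟫ = ⟪x, sref α y⟫ := by
  rw [inner_sref_left, real_inner_comm (sref α y) x, inner_sref_left, real_inner_comm x y,
    real_inner_comm α y, real_inner_comm x α]
  ring

theorem sref_self {α : V} (hα : α ≠ 0) : sref α α = -α := by
  have h : ⟪α, α⟫ ≠ 0 := inner_self_ne_zero.mpr hα
  rw [sref, mul_div_assoc, div_self h, mul_one, two_smul]
  abel

theorem sref_sub_smul (α x y : V) (c : ℝ) : sref α (x - c • y) = sref α x - c • sref α y := by
  simp only [sref, inner_sub_left, real_inner_smul_left]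
  module

theorem sref_sref {α : V} (hα : α ≠ 0) (x : V) : sref α (sref α x) = x := by
  conv_lhs => rw [show sref α x = x - (2 * ⟪x, α⟫ / ⟪α, α⟫) • α from rfl]
  rw [sref_sub_smul, sref_self hα, sref]
  module

theorem inner_sref_sref {α : V} (hα : α ≠ 0) (x y : V) : ⟪sref α x, sref α y⟫ = ⟪x, y⟫ := by
  rw [← inner_sref_comm, sref_sref hα]

theorem sref_sref_conj {α : V} (hα : α ≠ 0) (β x : V) :
    sref β (sref α x) = sref α (sref (sref α β) x) := by
  conv_rhs => rw [show sref (sref α β) x =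
    x - (2 * ⟪x, sref α β⟫ / ⟪sref α β, sref α β⟫) • sref α β from rfl]
  rw [sref_sub_smul, sref_sref hα, inner_sref_sref hα, ← inner_sref_comm]
  rfl

end Reflections

namespace RSD

variable {V : Type*} [NormedAddCommGroup V] [InnerProductSpace ℝ V]

theorem simple_mem_R (S : RSD V) (i : Fin S.n) : S.simple i ∈ S.R := S.pos_sub (S.simple_mem i)

theorem simple_ne_zero (S : RSD V) (i : Fin S.n) : S.simple i ≠ 0 :=
  S.root_ne_zero _ (S.simple_mem_R i)

theorem sum_smul_simple_injective (S : RSD V) {c d : Fin S.n → ℝ}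
    (h : ∑ i, c i • S.simple i = ∑ i, d i • S.simple i) : c = d := by
  have h0 := Fintype.linearIndependent_iff.mp S.simple_indep (fun i => c i - d i)
    (by simp [sub_smul, Finset.sum_sub_distrib, h])
  exact funext fun i => sub_eq_zero.mp (h0 i)

theorem htZ_sum (S : RSD V) (c : Fin S.n → ℤ) :
    S.htZ (∑ i, (c i : ℝ) • S.simple i) = ∑ i, c i := by
  have h : ∃ d : Fin S.n → ℤ,
      ∑ i, (c i : ℝ) • S.simple i = ∑ i, (d i : ℝ) • S.simple i := ⟨c, rfl⟩
  rw [htZ, dif_pos h]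
  have := S.sum_smul_simple_injective h.choose_spec
  exact Finset.sum_congr rfl fun i _ => (by exact_mod_cast (congrFun this i).symm)

theorem htZ_sub_smul_simple (S : RSD V) {x : V} (hx : S.inQ x) (k : ℤ) (j : Fin S.n) :
    S.htZ (x - (k : ℝ) • S.simple j) = S.htZ x - k := by
  obtain ⟨c, rfl⟩ := hx
  have h : ∑ i, (c i : ℝ) • S.simple i - (k : ℝ) • S.simple j =
      ∑ i, ((c i - if i = j then k else 0 : ℤ) : ℝ) • S.simple i := by
    simp [sub_smul, Finset.sum_sub_distrib, ite_smul]
  rw [h, htZ_sum, htZ_sum]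
  simp

theorem inQ_of_mem (S : RSD V) {x : V} (hx : x ∈ S.R) : S.inQ x := by
  rcases S.pos_or_neg x hx with h | h
  · obtain ⟨c, hc⟩ := S.pos_combo _ h
    exact ⟨fun i => c i, by simpa using hc⟩
  · obtain ⟨c, hc⟩ := S.pos_combo _ h
    refine ⟨fun i => -(c i : ℤ), ?_⟩
    rw [← neg_neg x, hc]
    simp

theorem inner_nonneg_of_dominant (S : RSD V) {x : V} (hx : S.Dominant x) {β : V}
    (hβ : β ∈ S.Rpos) : 0 ≤ ⟪x, β⟫ := by
  obtain ⟨c, rfl⟩ := S.pos_combo _ hβ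
  rw [inner_sum]
  refine Finset.sum_nonneg fun i _ => ?_
  rw [real_inner_smul_right]
  exact mul_nonneg (Nat.cast_nonneg _) (hx i)

theorem mem_Rpos_of_dominant (S : RSD V) {x : V} (hx : S.Dominant x) (hR : x ∈ S.R) :
    x ∈ S.Rpos := by
  refine (S.pos_or_neg x hR).resolve_right fun h => ?_
  have h1 := S.inner_nonneg_of_dominant hx h
  rw [inner_neg_right] at h1
  have h2 := real_inner_self_pos.mpr (S.root_ne_zero x hR)
  linarith

/-- A simple reflection permutes the positive roots other than its simple root. -/
theorem sref_simple_mem_Rpos (S : RSD V) {β : V} (hβ : β ∈ S.Rpos) (j : Fin S.n)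
    (hne : β ≠ S.simple j) : sref (S.simple j) β ∈ S.Rpos := by
  refine (S.pos_or_neg _ (S.refl_mem _ (S.simple_mem_R j) _ (S.pos_sub hβ))).resolve_right
    fun hneg => hne ?_
  obtain ⟨c, hc⟩ := S.pos_combo _ hβ
  obtain ⟨d, hd⟩ := S.pos_combo _ hneg
  set t : ℝ := 2 * ⟪β, S.simple j⟫ / ⟪S.simple j, S.simple j⟫ with ht
  have hsum : ∑ i, ((c i : ℝ) + d i) • S.simple i =
      ∑ i, (if i = j then t else 0) • S.simple i := by
    simp only [add_smul, Finset.sum_add_distrib, ← hc, ← hd, ite_smul, zero_smul,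
      Finset.sum_ite_eq', Finset.mem_univ, if_true]
    rw [sref, ← ht]
    abel
  have hcoef := S.sum_smul_simple_injective hsum
  have hc0 : ∀ i, i ≠ j → (c i : ℝ) = 0 := fun i hi => by
    have h := congrFun hcoef i
    simp only [hi, if_false] at h
    have h1 : (0 : ℝ) ≤ c i := Nat.cast_nonneg _
    have h2 : (0 : ℝ) ≤ d i := Nat.cast_nonneg _
    linarith
  have hβj : β = (c j : ℝ) • S.simple j := by
    conv_lhs => rw [hc]
    exact Finset.sum_eq_single j (fun i _ hi => by rw [hc0 i hi, zero_smul]) (by simp)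
  have hred := S.reduced _ (S.simple_mem_R j) (c j) (hβj ▸ S.pos_sub hβ)
  rcases hred with h | h
  · rw [hβj, h, one_smul]
  · have h1 : (0 : ℝ) ≤ c j := Nat.cast_nonneg _
    linarith

@[simp]
theorem wordMap_nil (S : RSD V) (x : V) : S.wordMap [] x = x := rfl

@[simp]
theorem wordMap_cons (S : RSD V) (i : Fin S.n) (l : List (Fin S.n)) (x : V) :
    S.wordMap (i :: l) x = sref (S.simple i) (S.wordMap l x) := rfl

theorem IsShort.sref_simple {S : RSD V} {x : V} (hx : S.IsShort x) (i : Fin S.n) :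
    S.IsShort (sref (S.simple i) x) :=
  ⟨S.refl_mem _ (S.simple_mem_R i) _ hx.1, fun β hβ => by
    rw [inner_sref_sref (S.simple_ne_zero i)]
    exact hx.2 β hβ⟩

theorem IsShort.wordMap {S : RSD V} {x : V} (hx : S.IsShort x) (l : List (Fin S.n)) :
    S.IsShort (S.wordMap l x) := by
  induction l with
  | nil => exact hx
  | cons i l ih => exact ih.sref_simple i

/-- The exchange condition for the orbit of a dominant vector. -/
theorem exists_shorter_word (S : RSD V) {x : V} (hx : S.Dominant x) (l : List (Fin S.n))
    {β : V} (hβ : β ∈ S.Rpos) (hneg : ⟪S.wordMap l x, β⟫ < 0) :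
    ∃ l' : List (Fin S.n), l'.length < l.length ∧ S.wordMap l' x = sref β (S.wordMap l x) := by
  induction l generalizing β with
  | nil => exact absurd (S.inner_nonneg_of_dominant hx hβ) (not_le.mpr hneg)
  | cons j l ih =>
    have hj := S.simple_ne_zero j
    by_cases h : β = S.simple j
    · exact ⟨l, by simp, by rw [h, wordMap_cons, sref_sref hj]⟩
    · rw [wordMap_cons, inner_sref_comm] at hneg
      obtain ⟨l', hlen, hl'⟩ := ih (S.sref_simple_mem_Rpos hβ j h) hneg
      exact ⟨j :: l', by simpa using hlen, by
        rw [wordMap_cons, hl', wordMap_cons, sref_sref_conj hj]⟩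

/-- A simple root pairing positively with a different short root has Cartan integer `1`. -/
theorem IsShort.sref_simple_eq_sub {S : RSD V} {x : V} (hx : S.IsShort x) (i : Fin S.n)
    (hpos : 0 < ⟪x, S.simple i⟫) (hne : x ≠ S.simple i) :
    sref (S.simple i) x = x - ((1 : ℤ) : ℝ) • S.simple i := by
  obtain ⟨k, hk⟩ := S.crystal _ (S.simple_mem_R i) _ hx.1
  have hα := real_inner_self_pos.mpr (S.simple_ne_zero i)
  have hk' : 2 * ⟪x, S.simple i⟫ / ⟪S.simple i, S.simple i⟫ = k := by
    rw [← hk, coroot, real_inner_smul_right]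
    ring
  have hmul : 2 * ⟪x, S.simple i⟫ = k * ⟪S.simple i, S.simple i⟫ :=
    (div_eq_iff hα.ne').mp hk'
  have hk0 : 0 < k := by
    have : (0 : ℝ) < k := hk' ▸ by positivity
    exact_mod_cast this
  have hk2 : k < 2 := by
    by_contra! h
    have h2 : (2 : ℝ) ≤ k := by exact_mod_cast h
    have hsub := real_inner_self_pos.mpr (sub_ne_zero.mpr hne)
    rw [real_inner_sub_sub_self] at hsub
    have := hx.2 _ (S.simple_mem_R i)
    nlinarith
  obtain rfl : k = 1 := by omega
  rw [sref, hk']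

/-- Along a shortest word from a dominant short root, each letter lowers the height by one,
except for the letter that crosses from the positive to the negative roots. -/
theorem htZ_sub_htZ_wordMap (S : RSD V) {x : V} (hx : S.Dominant x) (hs : S.IsShort x)
    (l : List (Fin S.n))
    (hmin : ∀ l' : List (Fin S.n), S.wordMap l' x = S.wordMap l x → l.length ≤ l'.length) :
    (S.wordMap l x ∈ S.Rpos → S.htZ x - S.htZ (S.wordMap l x) = l.length) ∧
      (-S.wordMap l x ∈ S.Rpos → S.htZ x - S.htZ (S.wordMap l x) = l.length + 1) := by
  induction l with
  | nil =>
    have h := S.mem_Rpos_of_dominant hx hs.1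
    exact ⟨fun _ => by simp, fun h' => absurd h' (S.not_both _ h)⟩
  | cons i l ih =>
    have hi := S.simple_ne_zero i
    replace ih := ih fun l' hl' => by
      simpa using hmin (i :: l') (by rw [wordMap_cons, wordMap_cons, hl'])
    have hl := hs.wordMap l
    have hpos : 0 < ⟪S.wordMap l x, S.simple i⟫ := by
      rcases lt_trichotomy 0 ⟪S.wordMap l x, S.simple i⟫ with h | h | h
      · exact h
      · have := hmin l (by rw [wordMap_cons, sref, ← h]; simp)
        simp at this
      · obtain ⟨l', hlen, hl'⟩ := S.exists_shorter_word hx l (S.simple_mem i) h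
        have := hmin l' hl'
        simp only [List.length_cons] at this
        omega
    rw [wordMap_cons, List.length_cons]
    by_cases hne : S.wordMap l x = S.simple i
    · have hp := ih.1 (hne ▸ S.simple_mem i)
      have heq : sref (S.simple i) (S.wordMap l x) =
          S.wordMap l x - ((2 : ℤ) : ℝ) • S.simple i := by
        rw [hne, sref_self hi, Int.cast_ofNat, two_smul]
        abel
      have hht := S.htZ_sub_smul_simple (S.inQ_of_mem hl.1) 2 i
      rw [← heq] at hht
      refine ⟨fun h => ?_, fun _ => ?_⟩
      · rw [hne, sref_self hi] at h
        exact absurd h (S.not_both _ (S.simple_mem i))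
      · rw [hht]
        push_cast
        omega
    · have hht := S.htZ_sub_smul_simple (S.inQ_of_mem hl.1) 1 i
      rw [← hl.sref_simple_eq_sub i hpos hne] at hht
      rw [hht]
      push_cast
      rcases S.pos_or_neg _ hl.1 with h | h
      · have h1 := S.sref_simple_mem_Rpos h i hne
        have := ih.1 h
        exact ⟨fun _ => by omega, fun h' => absurd h' (S.not_both _ h1)⟩
      · have hne' : -S.wordMap l x ≠ S.simple i := fun he => by
          have h2 := real_inner_self_nonneg (x := S.wordMap l x)
          rw [← he, inner_neg_right] at hpos
          linarith
        have h1 := S.sref_simple_mem_Rpos h i hne'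
        have hn : sref (S.simple i) (-S.wordMap l x) = -sref (S.simple i) (S.wordMap l x) := by
          simp only [sref, inner_neg_left]
          module
        rw [hn] at h1
        have := ih.2 h
        exact ⟨fun h' => absurd h1 (S.not_both _ h'), fun _ => by omega⟩

end RSD

/-- If `λ` is a short root then `D_λ = 0` if `λ` is a positive root and
`D_λ = 1` if `λ` is a negative root, where `D_λ = ht(λ₊) − ht(λ) − ℓ(w_λ)`. -/
theorem D_of_short_root
    {V : Type*} [NormedAddCommGroup V] [InnerProductSpace ℝ V]
    (S : RSD V) (lam : V) (hshort : S.IsShort lam)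
    (lamp : V) (hdom : S.Dominant lamp) (horb : S.sameOrbit lam lamp)
    (w : V → V) (hw : S.IsMinWord lamp lam w) :
    (lam ∈ S.Rpos → S.htZ lamp - S.htZ lam - (S.len w : ℤ) = 0) ∧
      (-lam ∈ S.Rpos → S.htZ lamp - S.htZ lam - (S.len w : ℤ) = 1) := by
  obtain ⟨⟨l₀, hl₀⟩, hwx, hmin⟩ := hw
  obtain ⟨l, hlen, rfl⟩ : S.len w ∈ {k | ∃ l : List (Fin S.n), l.length = k ∧ w = S.wordMap l} :=
    Nat.sInf_mem ⟨_, l₀, rfl, hl₀⟩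
  obtain ⟨_, ⟨m, rfl⟩, rfl⟩ := horb
  have key := S.htZ_sub_htZ_wordMap hdom (hshort.wordMap m) l fun l' hl' => by
    rw [hlen]
    exact (hmin _ ⟨l', rfl⟩ (hl'.trans hwx)).trans (Nat.sInf_le ⟨l', rfl, rfl⟩)
  rw [hwx, hlen] at key
  exact ⟨fun h => by have := key.1 h; omega, fun h => by have := key.2 h; omega⟩

end
end

section
/- Let μ be a dominant element of the root lattice Q which is a sum of two orthogonal short roots and is not itself a root. Then for every positive root α one has (μ, α^∨) ∈ {0, 1, 2}, and if (μ, α^∨) = 2 then α is a short root. -/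
open scoped RealInnerProductSpace

attribute [local instance] Classical.propDecidable

noncomputable section

namespace RSD

variable {V : Type*} [NormedAddCommGroup V] [InnerProductSpace ℝ V]

theorem inner_coroot_mul (S : RSD V) {α : V} (hα : α ∈ S.R) (x : V) :
    ⟪x, coroot α⟫ * ⟪α, α⟫ = 2 * ⟪x, α⟫ := by
  have h0 : ⟪α, α⟫ ≠ 0 := inner_self_ne_zero.mpr (S.root_ne_zero α hα)
  rw [coroot, real_inner_smul_right]
  field_simp

theorem inner_self_pos_of_mem (S : RSD V) {α : V} (hα : α ∈ S.R) : 0 < ⟪α, α⟫ :=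
  real_inner_self_pos.mpr (S.root_ne_zero α hα)

theorem Dominant.inner_nonneg {S : RSD V} {x α : V} (hx : S.Dominant x) (hα : α ∈ S.Rpos) :
    0 ≤ ⟪x, α⟫ := by
  obtain ⟨c, rfl⟩ := S.pos_combo α hα
  rw [inner_sum]
  refine Finset.sum_nonneg fun i _ => ?_
  rw [real_inner_smul_right]
  exact mul_nonneg (Nat.cast_nonneg _) (hx i)

theorem Dominant.inner_coroot_nonneg {S : RSD V} {x α : V} (hx : S.Dominant x)
    (hα : α ∈ S.Rpos) : 0 ≤ ⟪x, coroot α⟫ := by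
  have h := S.inner_coroot_mul (S.pos_sub hα) x
  have h1 := hx.inner_nonneg hα
  have h2 := S.inner_self_pos_of_mem (S.pos_sub hα)
  exact nonneg_of_mul_nonneg_left (by linarith) h2

/-- The pairing of a short root with a coroot is an integer in `[-2, 2]`, and the extreme values
are attained only for parallel roots. -/
theorem IsShort.exists_inner_coroot_eq {S : RSD V} {β α : V} (hβ : S.IsShort β) (hα : α ∈ S.R) :
    ∃ k : ℤ, ⟪β, coroot α⟫ = k ∧ -2 ≤ k ∧ k ≤ 2 ∧ (k = 2 → β = α) ∧ (k = -2 → β = -α) := by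
  obtain ⟨k, hk⟩ := S.crystal α hα β hβ.1
  have h := S.inner_coroot_mul hα β
  rw [hk] at h
  have ha := S.inner_self_pos_of_mem hα
  have hba := hβ.2 α hα
  have hsub := real_inner_sub_sub_self β α
  have hadd := real_inner_add_add_self β α
  have hsub0 := real_inner_self_nonneg (x := β - α)
  have hadd0 := real_inner_self_nonneg (x := β + α)
  refine ⟨k, hk, ?_, ?_, ?_, ?_⟩
  · have : (-2 : ℝ) ≤ k := by
      by_contra! hlt
      nlinarith
    exact_mod_cast this
  · have : (k : ℝ) ≤ 2 := by
      by_contra! hlt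
      nlinarith
    exact_mod_cast this
  · rintro rfl
    push_cast at h
    exact sub_eq_zero.mp (inner_self_eq_zero (𝕜 := ℝ).mp (by linarith))
  · rintro rfl
    push_cast at h
    exact eq_neg_of_add_eq_zero_left (inner_self_eq_zero (𝕜 := ℝ).mp (by linarith))

theorem IsShort.of_inner_self_le {S : RSD V} {β α : V} (hβ : S.IsShort β) (hα : α ∈ S.R)
    (h : ⟪α, α⟫ ≤ ⟪β, β⟫) : S.IsShort α :=
  ⟨hα, fun δ hδ => h.trans (hβ.2 δ hδ)⟩

/-- A root pairing to `1` with two orthogonal short roots is short or equal to their sum. -/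
theorem isShort_or_eq_add {S : RSD V} {α β γ : V} (hα : α ∈ S.R) (hβ : S.IsShort β)
    (hγ : S.IsShort γ) (horth : ⟪β, γ⟫ = 0) (h1 : ⟪β, coroot α⟫ = 1) (h2 : ⟪γ, coroot α⟫ = 1) :
    S.IsShort α ∨ α = β + γ := by
  rcases le_or_gt ⟪α, α⟫ ⟪β, β⟫ with hle | hlt
  · exact .inl (hβ.of_inner_self_le hα hle)
  right
  have e1 := S.inner_coroot_mul hα β
  have e2 := S.inner_coroot_mul hα γ
  rw [h1] at e1
  rw [h2] at e2
  have hb := S.inner_self_pos_of_mem hβ.1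
  have hβγ := le_antisymm (hβ.2 γ hγ.1) (hγ.2 β hβ.1)
  obtain ⟨m, hm⟩ := S.crystal β hβ.1 α hα
  have e3 := S.inner_coroot_mul hβ.1 α
  rw [hm, real_inner_comm β α] at e3
  have hm2 : (2 : ℝ) ≤ m := by
    have : (1 : ℝ) < m := by
      by_contra! hle
      nlinarith
    have : (1 : ℤ) < m := by exact_mod_cast this
    exact_mod_cast this
  have hab : 2 * ⟪β, β⟫ ≤ ⟪α, α⟫ := by nlinarith
  have hsub := real_inner_sub_sub_self (β + γ) α
  rw [real_inner_add_add_self, inner_add_left, horth] at hsub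
  have hsub0 := real_inner_self_nonneg (x := β + γ - α)
  exact (sub_eq_zero.mp (inner_self_eq_zero (𝕜 := ℝ).mp (by linarith))).symm

end RSD

/-- Let `μ ∈ Q` be dominant, a sum of two orthogonal short roots, and not
itself a root. Then for every positive root `α`, `(μ, α^∨) ∈ {0, 1, 2}`, and if
`(μ, α^∨) = 2` then `α` is a short root. -/
theorem pairing_with_dominant_sum_of_orthogonal_short_roots
    {V : Type*} [NormedAddCommGroup V] [InnerProductSpace ℝ V]
    (S : RSD V) (μ : V) (hQ : S.inQ μ) (hdom : S.Dominant μ)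
    (hsum : ∃ α β : V, S.IsShort α ∧ S.IsShort β ∧ ⟪α, β⟫ = 0 ∧ μ = α + β)
    (hnotroot : μ ∉ S.R) :
    ∀ α ∈ S.Rpos,
      (⟪μ, coroot α⟫ = 0 ∨ ⟪μ, coroot α⟫ = 1 ∨ ⟪μ, coroot α⟫ = 2) ∧
        (⟪μ, coroot α⟫ = 2 → S.IsShort α) := by
  obtain ⟨β, γ, hβ, hγ, horth, rfl⟩ := hsum
  intro α hα
  have hαR := S.pos_sub hα
  have hnonneg := hdom.inner_coroot_nonneg hα
  obtain ⟨k, hk, hk1, hk2, hk3, hk4⟩ := hβ.exists_inner_coroot_eq hαR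
  obtain ⟨l, hl, hl1, hl2, hl3, hl4⟩ := hγ.exists_inner_coroot_eq hαR
  have horth' : k = 2 ∨ k = -2 → l = 0 := by
    intro h
    have hγα : ⟪γ, α⟫ = 0 := by
      rw [real_inner_comm]
      rcases h with h | h
      · rwa [← hk3 h]
      · rwa [← neg_eq_iff_eq_neg.mpr (hk4 h), inner_neg_left, neg_eq_zero]
    rw [coroot, real_inner_smul_right, hγα, mul_zero] at hl
    exact_mod_cast hl.symm
  have horth'' : l = 2 ∨ l = -2 → k = 0 := by
    intro h
    have hβα : ⟪β, α⟫ = 0 := by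
      rcases h with h | h
      · rwa [← hl3 h]
      · rwa [← neg_eq_iff_eq_neg.mpr (hl4 h), inner_neg_right, neg_eq_zero]
    rw [coroot, real_inner_smul_right, hβα, mul_zero] at hk
    exact_mod_cast hk.symm
  have hsum : ⟪β + γ, coroot α⟫ = ((k + l : ℤ) : ℝ) := by
    rw [inner_add_left, hk, hl, Int.cast_add]
  rw [hsum] at hnonneg ⊢
  norm_cast at hnonneg ⊢
  refine ⟨by omega, fun h => ?_⟩
  rcases (by omega : k = 2 ∨ l = 2 ∨ (k = 1 ∧ l = 1)) with h | h | ⟨rfl, rfl⟩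
  · exact hk3 h ▸ hβ
  · exact hl3 h ▸ hγ
  · refine (RSD.isShort_or_eq_add hαR hβ hγ horth (by simpa using hk)
      (by simpa using hl)).resolve_right ?_
    rintro rfl
    exact hnotroot hαR

end
end
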